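/- If dim_k H(R) ≥ 2, then the DG left-R-module k (that is, k = R/R^{≥1} viewed in D(R)) is not in D^c(R). -/

import Mathlib

/-!
# Preamble: an interface for the derived category of DG modules over a cochain DG algebra

We formalize the setting of the paper "Calabi-Yau categories and Poincaré duality spaces".
Let `k` be a field and `R` a DG algebra over `k` with `R^{<0} = 0`, `R^0 = k`, `R^1 = 0`
and `dim_k R < ∞`.  Since the derived category `D(R)` of DG left-`R`-modules (and the derived
category `D(R^o)` of DG right-`R`-modules) is not available in Mathlib, we axiomatize it:
`C` (resp. `Co`) is a `k`-linear triangulated category playing the role of `D(R)`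
(resp. `D(R^o)`), and a `DGSetup` records the distinguished objects (`R`, `k = R/R^{≥1}`,
the dual `D(R) = Hom_k(R,k)`, ...) and operations used in the paper, together with the
standing assumptions of the paper, expressed in terms of cohomology.  Cohomology is
faithfully encoded via `H^i(M) = Hom_{D(R)}(R, Σ^i M)`, so that e.g. the graded algebra
structure of `H(R)` is the (Yoneda) composition product, and `Ext^i_R(M,N) = Hom_{D(R)}(M, Σ^i N)`.
-/

open CategoryTheory CategoryTheory.Limits CategoryTheory.Pretriangulated

universe v u

section Preamble

variable (k : Type u) [Field k]
variable (C : Type u) [Category.{v} C] [Preadditive C] [HasZeroObject C] [HasShift C ℤ]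
  [∀ n : ℤ, (shiftFunctor C n).Additive] [Pretriangulated C]
  [Linear k C] [HasFiniteBiproducts C] [∀ n : ℤ, Functor.Linear k (shiftFunctor C n)]

/-- The objects finitely built from `R₀` using distinguished triangles, (de)suspensions,
(finite) coproducts and direct summands, i.e. the thick subcategory generated by `R₀`.
For `R₀ = R` this is the class of compact objects, i.e. the subcategory `D^c(R)`. -/
inductive FinitelyBuilt (R₀ : C) : C → Prop
  | base : FinitelyBuilt R₀ R₀
  | iso {M N : C} : (M ≅ N) → FinitelyBuilt R₀ M → FinitelyBuilt R₀ N
  | shift {M : C} (n : ℤ) : FinitelyBuilt R₀ M → FinitelyBuilt R₀ (M⟦n⟧)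
  | cone {X Y Z : C} (f : X ⟶ Y) (g : Y ⟶ Z) (h : Z ⟶ X⟦(1 : ℤ)⟧) :
      (Triangle.mk f g h ∈ distTriang C) → FinitelyBuilt R₀ X → FinitelyBuilt R₀ Y →
      FinitelyBuilt R₀ Z
  | retract {M N : C} (i : N ⟶ M) (r : M ⟶ N) : i ≫ r = 𝟙 N →
      FinitelyBuilt R₀ M → FinitelyBuilt R₀ N

/-- An Auslander-Reiten triangle `X → Y → Z → ΣX` in the full subcategory of a pretriangulated
category determined by the class of objects `P`: a distinguished triangle with nonzero
connecting map, such that every morphism out of `X` (in the subcategory) which is not a split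
monomorphism factors through `f`, and every morphism into `Z` which is not a split epimorphism
factors through `g`. -/
structure IsARTriangle (P : Set C) {X Y Z : C} (f : X ⟶ Y) (g : Y ⟶ Z)
    (h : Z ⟶ X⟦(1 : ℤ)⟧) : Prop where
  memX : X ∈ P
  memY : Y ∈ P
  memZ : Z ∈ P
  dist : Triangle.mk f g h ∈ distTriang C
  h_ne : h ≠ 0
  fac_left : ∀ N' : C, N' ∈ P → ∀ u : X ⟶ N',
      ¬ (∃ r : N' ⟶ X, u ≫ r = 𝟙 X) → ∃ v : Y ⟶ N', f ≫ v = u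
  fac_right : ∀ N' : C, N' ∈ P → ∀ v : N' ⟶ Z,
      ¬ (∃ s : Z ⟶ N', s ≫ v = 𝟙 Z) → ∃ u : N' ⟶ Y, u ≫ g = v

/-- The subcategory of objects `P` has right AR triangles: for every object `Z` of `P` with
local endomorphism ring there is an AR triangle ending in `Z`. -/
def HasRightARTriangles (P : Set C) : Prop :=
  ∀ Z : C, Z ∈ P → IsLocalRing (End Z) →
    ∃ (X Y : C) (f : X ⟶ Y) (g : Y ⟶ Z) (h : Z ⟶ X⟦(1 : ℤ)⟧), IsARTriangle C P f g h

/-- The subcategory of objects `P` has left AR triangles: for every object `X` of `P` with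
local endomorphism ring there is an AR triangle starting in `X`. -/
def HasLeftARTriangles (P : Set C) : Prop :=
  ∀ X : C, X ∈ P → IsLocalRing (End X) →
    ∃ (Y Z : C) (f : X ⟶ Y) (g : Y ⟶ Z) (h : Z ⟶ X⟦(1 : ℤ)⟧), IsARTriangle C P f g h

/-- The subcategory of objects `P` has AR triangles if it has both right and left ones. -/
def HasARTriangles (P : Set C) : Prop :=
  HasRightARTriangles C P ∧ HasLeftARTriangles C P

/-- An object is indecomposable if it is nonzero and in any direct sum decomposition one
of the summands vanishes. -/
def Indec (M : C) : Prop :=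
  ¬ IsZero M ∧ ∀ A B : C, Nonempty (M ≅ A ⊞ B) → IsZero A ∨ IsZero B

/-- An irreducible morphism in the full subcategory of objects `P`: a non-isomorphism such
that in any factorization through an object of `P`, the first factor is a split monomorphism
or the second factor is a split epimorphism. -/
def IrredMor (P : Set C) {M N : C} (f : M ⟶ N) : Prop :=
  ¬ IsIso f ∧ ∀ L : C, L ∈ P → ∀ (σ : M ⟶ L) (ρ : L ⟶ N), σ ≫ ρ = f →
    (∃ s : N ⟶ L, s ≫ ρ = 𝟙 N) ∨ (∃ r : L ⟶ M, σ ≫ r = 𝟙 M)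

/-- The indecomposable objects belonging to the class `P`. -/
abbrev IndecObj (P : Set C) : Type _ := {M : C // M ∈ P ∧ Indec C M}

/-- Isomorphism, as an equivalence relation on the indecomposable objects in `P`. -/
def isoSetoid (P : Set C) : Setoid (IndecObj C P) where
  r M N := Nonempty (M.1 ≅ N.1)
  iseqv := ⟨fun M => ⟨Iso.refl M.1⟩, fun ⟨e⟩ => ⟨e.symm⟩, fun ⟨e⟩ ⟨e'⟩ => ⟨e ≪≫ e'⟩⟩

/-- The vertices of the AR quiver of the full subcategory of objects `P`: isomorphism
classes of indecomposable objects in `P`. -/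
def ARVertex (P : Set C) : Type _ := Quotient (isoSetoid C P)

/-- The vertex of the AR quiver given by an indecomposable object. -/
def vertexOf (P : Set C) (M : IndecObj C P) : ARVertex C P :=
  Quotient.mk (isoSetoid C P) M

/-- There is an arrow `[M] → [N]` in the AR quiver iff there is an irreducible morphism
`M → N` between representatives. -/
def VArrow (P : Set C) (v w : ARVertex C P) : Prop :=
  ∃ (M N : IndecObj C P) (f : M.1 ⟶ N.1),
    IrredMor C P f ∧ vertexOf C P M = v ∧ vertexOf C P N = w

/-- Two vertices of the AR quiver lie in the same component iff they are connected by a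
finite zigzag of arrows. -/
def sameComponent (P : Set C) (v w : ARVertex C P) : Prop :=
  Relation.EqvGen (fun v w => VArrow C P v w ∨ VArrow C P w v) v w

/-- The set of components of the AR quiver of the full subcategory of objects `P`. -/
def ARComponents (P : Set C) : Type _ :=
  Quotient (Relation.EqvGen.setoid (fun v w => VArrow C P v w ∨ VArrow C P w v))

/-- The component of the AR quiver containing a given vertex. -/
def componentOf (P : Set C) (v₀ : ARVertex C P) : Set (ARVertex C P) :=
  {v | sameComponent C P v v₀}

/-- An AR translation for the subcategory of objects `P`: the assignment `N ↦ τN` on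
indecomposable objects given by the left hand end terms of AR triangles.  (The end terms
of an AR triangle determine each other up to isomorphism, so `τ` is well defined up to
isomorphism; accordingly any choice satisfies `iso_congr`.) -/
structure ARTranslation (P : Set C) where
  τ : IndecObj C P → IndecObj C P
  triangle : ∀ N : IndecObj C P, ∃ (Y : C) (f : (τ N).1 ⟶ Y) (g : Y ⟶ N.1)
      (h : N.1 ⟶ ((τ N).1)⟦(1 : ℤ)⟧), IsARTriangle C P f g h
  iso_congr : ∀ M N : IndecObj C P, Nonempty (M.1 ≅ N.1) → Nonempty ((τ M).1 ≅ (τ N).1)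

/-- The vertices of the repetitive quiver `ℤA∞`: pairs `(p, n)`, `p ∈ ℤ`, `n ≥ 1`. -/
abbrev ZAVertex : Type := ℤ × ℕ+

/-- The arrows of `ℤA∞`: `(p, n) → (p, n+1)` and `(p, n+1) → (p-1, n)`. -/
def ZAArrow (v w : ZAVertex) : Prop :=
  (w.1 = v.1 ∧ w.2 = v.2 + 1) ∨ (w.1 = v.1 - 1 ∧ v.2 = w.2 + 1)

/-- The translation of the stable translation quiver `ℤA∞`: `τ(p, n) = (p+1, n)`. -/
def ZATrans (v : ZAVertex) : ZAVertex := (v.1 + 1, v.2)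

/-- A set of vertices (a component) of the AR quiver, with translation `τv`, is isomorphic
to `ℤA∞` as a stable translation quiver: it is stable under the translation and there is a
bijection with the vertices of `ℤA∞` matching arrows with arrows and translation with
translation. -/
def IsZAInftyComponent (P : Set C) (τv : ARVertex C P → ARVertex C P)
    (comp : Set (ARVertex C P)) : Prop :=
  ∃ (hτ : ∀ v ∈ comp, τv v ∈ comp) (θ : comp ≃ ZAVertex),
    (∀ v w : comp, VArrow C P v.1 w.1 ↔ ZAArrow (θ v) (θ w)) ∧
    (∀ v : comp, θ ⟨τv v.1, hτ v.1 v.2⟩ = ZATrans (θ v))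

/-- A functor `F` is a Serre functor for the full subcategory of objects `P` of the `k`-linear
category `C`: it preserves `P` and there are isomorphisms
`Hom_k(Hom(M,N), k) ≅ Hom(N, F M)` natural in `M` and `N`. -/
def IsSerreFunctorOn (P : Set C) (F : C ⥤ C) : Prop :=
  (∀ M : C, M ∈ P → F.obj M ∈ P) ∧
  ∃ η : ∀ M N : C, M ∈ P → N ∈ P → Module.Dual k (M ⟶ N) ≃ₗ[k] (N ⟶ F.obj M),
    (∀ (M N N' : C) (hM : M ∈ P) (hN : N ∈ P) (hN' : N' ∈ P) (g : N' ⟶ N)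
        (ψ : Module.Dual k (M ⟶ N)),
        η M N' hM hN' (ψ.comp (Linear.rightComp k M g)) = g ≫ η M N hM hN ψ) ∧
    (∀ (M M' N : C) (hM : M ∈ P) (hM' : M' ∈ P) (hN : N ∈ P) (f : M ⟶ M')
        (ψ : Module.Dual k (M ⟶ N)),
        η M' N hM' hN (ψ.comp (Linear.leftComp k N f)) = η M N hM hN ψ ≫ F.map f)

/-- The `n`-th power of the suspension is a Serre functor for the subcategory of objects `P`. -/
def IsSerreShift (P : Set C) (n : ℤ) : Prop :=
  IsSerreFunctorOn k C P (shiftFunctor C n)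

/-- The full subcategory of objects `P` is an `n`-Calabi-Yau category: `n` is the smallest
non-negative integer such that `Σ^n` is a Serre functor. -/
def IsCalabiYau (P : Set C) (n : ℤ) : Prop :=
  0 ≤ n ∧ IsSerreShift k C P n ∧ ∀ m : ℤ, 0 ≤ m → m < n → ¬ IsSerreShift k C P m

/-- The full subcategory of objects `P` is a Krull-Schmidt category: every object is a finite
direct sum of objects with local endomorphism rings, and such a decomposition is unique up to
isomorphism and permutation of the summands. -/
def KrullSchmidtClass (P : Set C) : Prop :=
  (∀ M : C, M ∈ P → ∃ (n : ℕ) (Ys : Fin n → C),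
      (∀ j, Ys j ∈ P ∧ IsLocalRing (End (Ys j))) ∧ Nonempty (M ≅ ⨁ Ys)) ∧
  (∀ (n m : ℕ) (Ys : Fin n → C) (Zs : Fin m → C),
      (∀ j, IsLocalRing (End (Ys j))) → (∀ j, IsLocalRing (End (Zs j))) →
      Nonempty ((⨁ Ys) ≅ ⨁ Zs) →
      ∃ σ : Fin n ≃ Fin m, ∀ j, Nonempty (Ys j ≅ Zs (σ j)))

/-- Total finite dimensionality of `Ext(M,N) = ⊕_i Hom(M, Σ^i N)` over `k`. -/
def FinTotalExt (M N : C) : Prop :=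
  (∀ i : ℤ, FiniteDimensional k (M ⟶ N⟦i⟧)) ∧
    Set.Finite {i : ℤ | Nontrivial (M ⟶ N⟦i⟧)}

/-- The composition of a chain of morphisms `⋯ → Ms 2 → Ms 1 → Ms 0`. -/
def chainComp (Ms : ℕ → C) (fs : ∀ i, Ms (i + 1) ⟶ Ms i) : ∀ q, Ms q ⟶ Ms 0
  | 0 => 𝟙 (Ms 0)
  | (q + 1) => fs q ≫ chainComp Ms fs q

end Preamble

section Preamble2

variable {C : Type u} [Category.{v} C] [Preadditive C] [HasZeroObject C] [HasShift C ℤ]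
  [∀ n : ℤ, (shiftFunctor C n).Additive] [Pretriangulated C] [HasFiniteBiproducts C]

/-- The action of the AR translation on the vertices of the AR quiver. -/
def ARTranslation.vmap {P : Set C} (t : ARTranslation C P) :
    ARVertex C P → ARVertex C P :=
  Quotient.map t.τ fun M N h => t.iso_congr M N h

end Preamble2
section Setup

variable (k : Type u) [Field k]
variable (C : Type u) [Category.{v} C] [Preadditive C] [HasZeroObject C] [HasShift C ℤ]
  [∀ n : ℤ, (shiftFunctor C n).Additive] [Pretriangulated C]
  [Linear k C] [HasFiniteBiproducts C] [∀ n : ℤ, Functor.Linear k (shiftFunctor C n)]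
variable (Co : Type u) [Category.{v} Co] [Preadditive Co] [HasZeroObject Co] [HasShift Co ℤ]
  [∀ n : ℤ, (shiftFunctor Co n).Additive] [Pretriangulated Co]
  [Linear k Co] [HasFiniteBiproducts Co] [∀ n : ℤ, Functor.Linear k (shiftFunctor Co n)]

/-- The data of the paper's setting.  `C` plays the role of the derived category `D(R)` of DG
left modules over the cochain DG algebra `R` (with `R^{<0} = 0`, `R^0 = k`, `R^1 = 0` and
`dim_k R < ∞`), and `Co` plays the role of the derived category `D(R^o)` of DG right modules.
The fields record the objects and functors used in the paper, and the axioms record the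
standing assumptions, with cohomology encoded as `H^i(M) = Hom_{D(R)}(R, Σ^i M)`. -/
structure DGSetup where
  /-- the free DG module `R` as an object of `D(R)` -/
  R : C
  /-- the free DG module `R` as an object of `D(R^o)` -/
  Ro : Co
  /-- the DG bi-`R`-module `k = R/R^{≥1}` viewed as an object of `D(R)` -/
  kMod : C
  /-- `k = R/R^{≥1}` viewed as an object of `D(R^o)` -/
  kModo : Co
  /-- the dual `D(R) = Hom_k(R,k)` as a DG left module, i.e. as an object of `D(R)` -/
  DR : C
  /-- the dual `D(R) = Hom_k(R,k)` as a DG right module, i.e. as an object of `D(R^o)` -/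
  DRo : Co
  /-- the DG left module `RHom_{R^o}(D(R), R)` -/
  RHomDRR : C
  /-- the functor `D(R) ⊗^L_R - : D(R) → D(R)`, where the tensor product inherits the
  left `R`-structure from the DG bi-`R`-module `D(R)` -/
  tensDR : C ⥤ C
  /-- the functor `Σ RHom_{R^o}(D(R), R) ⊗^L_R - : D(R) → D(R)` -/
  homDR : C ⥤ C
  /-- the cohomology `H^i(M ⊗^L_R N)` of the derived tensor product of a DG right module
  `M` and a DG left module `N` -/
  Htensor : Co → C → ℤ → ModuleCat.{v} k
  /-- the supremum `d = sup { i | H^i(R) ≠ 0 }` -/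
  d : ℤ
  /-- the dimension `dim_k R` of the underlying DG algebra -/
  dimR : ℕ
  /-- `H^i(R) = 0` for `i < 0` -/
  HR_neg : ∀ i : ℤ, i < 0 → Subsingleton (R ⟶ R⟦i⟧)
  /-- `H^0(R) ≅ k` -/
  HR_zero : Nonempty ((R ⟶ R⟦(0 : ℤ)⟧) ≃ₗ[k] k)
  /-- `H^1(R) = 0` -/
  HR_one : Subsingleton (R ⟶ R⟦(1 : ℤ)⟧)
  /-- `dim_k H(R) < ∞`, degreewise finiteness -/
  HR_findim : ∀ i : ℤ, FiniteDimensional k (R ⟶ R⟦i⟧)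
  /-- `dim_k H(R) < ∞`, boundedness -/
  HR_bdd : Set.Finite {i : ℤ | Nontrivial (R ⟶ R⟦i⟧)}
  /-- `H^i(R) = 0` for `i < 0`, in `D(R^o)` -/
  HRo_neg : ∀ i : ℤ, i < 0 → Subsingleton (Ro ⟶ Ro⟦i⟧)
  /-- `H^0(R) ≅ k`, in `D(R^o)` -/
  HRo_zero : Nonempty ((Ro ⟶ Ro⟦(0 : ℤ)⟧) ≃ₗ[k] k)
  /-- `H^1(R) = 0`, in `D(R^o)` -/
  HRo_one : Subsingleton (Ro ⟶ Ro⟦(1 : ℤ)⟧)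
  /-- `dim_k H(R) < ∞`, degreewise finiteness, in `D(R^o)` -/
  HRo_findim : ∀ i : ℤ, FiniteDimensional k (Ro ⟶ Ro⟦i⟧)
  /-- `dim_k H(R) < ∞`, boundedness, in `D(R^o)` -/
  HRo_bdd : Set.Finite {i : ℤ | Nontrivial (Ro ⟶ Ro⟦i⟧)}
  /-- `H^d(R) ≠ 0` -/
  d_mem : Nontrivial (R ⟶ R⟦d⟧)
  /-- `d` bounds the degrees of the nonvanishing cohomology of `R` -/
  d_greatest : ∀ i : ℤ, Nontrivial (R ⟶ R⟦i⟧) → i ≤ d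
  /-- `H^0(k) ≅ k` -/
  Hk_zero : Nonempty ((R ⟶ kMod⟦(0 : ℤ)⟧) ≃ₗ[k] k)
  /-- `H^i(k) = 0` for `i ≠ 0` -/
  Hk_ne : ∀ i : ℤ, i ≠ 0 → Subsingleton (R ⟶ kMod⟦i⟧)
  /-- `H^0(k) ≅ k`, in `D(R^o)` -/
  Hko_zero : Nonempty ((Ro ⟶ kModo⟦(0 : ℤ)⟧) ≃ₗ[k] k)
  /-- `H^i(k) = 0` for `i ≠ 0`, in `D(R^o)` -/
  Hko_ne : ∀ i : ℤ, i ≠ 0 → Subsingleton (Ro ⟶ kModo⟦i⟧)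
  /-- `R ≠ 0`, so `dim_k R ≥ 1` -/
  dimR_pos : 0 < dimR
  /-- `D(R) ⊗^L_R R ≅ D(R)` -/
  tensDR_R : Nonempty (tensDR.obj R ≅ DR)
  /-- `Σ RHom_{R^o}(D(R), R) ⊗^L_R R ≅ Σ RHom_{R^o}(D(R), R)` -/
  homDR_R : Nonempty (homDR.obj R ≅ RHomDRR⟦(1 : ℤ)⟧)
  /-- `H(R ⊗^L_R N) ≅ H(N)` -/
  Htensor_R : ∀ (N : C) (i : ℤ), Nonempty ((Htensor Ro N i : Type v) ≃ₗ[k] (R ⟶ N⟦i⟧))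
  /-- `H(M ⊗^L_R R) ≅ H(M)` -/
  Htensor_Ro : ∀ (M : Co) (i : ℤ), Nonempty ((Htensor M R i : Type v) ≃ₗ[k] (Ro ⟶ M⟦i⟧))

namespace DGSetup

variable {k C Co}
variable (S : DGSetup k C Co)

/-- The cohomology `H^i(M) = Hom_{D(R)}(R, Σ^i M)` of a DG left module, a `k`-vector space. -/
abbrev H (M : C) (i : ℤ) : Type v := S.R ⟶ M⟦i⟧

/-- The cohomology `H^i(M) = Hom_{D(R^o)}(R, Σ^i M)` of a DG right module. -/
abbrev Ho (M : Co) (i : ℤ) : Type v := S.Ro ⟶ M⟦i⟧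

/-- `M` belongs to `D^f(R)`, the full subcategory of DG modules with `dim_k H(M) < ∞`. -/
def memDf (M : C) : Prop :=
  (∀ i : ℤ, FiniteDimensional k (S.H M i)) ∧ Set.Finite {i : ℤ | Nontrivial (S.H M i)}

/-- `M` belongs to `D^f(R^o)`. -/
def memDfo (M : Co) : Prop :=
  (∀ i : ℤ, FiniteDimensional k (S.Ho M i)) ∧ Set.Finite {i : ℤ | Nontrivial (S.Ho M i)}

/-- `M` belongs to `D^c(R)`, the full subcategory of compact objects, i.e. the objects
finitely built from `R`. -/
def memDc (M : C) : Prop := FinitelyBuilt C S.R M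

/-- `M` belongs to `D^c(R^o)`. -/
def memDco (M : Co) : Prop := FinitelyBuilt Co S.Ro M

/-- `D^f(R)` as a class of objects. -/
def Df : Set C := {M | S.memDf M}

/-- `D^c(R)` as a class of objects. -/
def Dc : Set C := {M | S.memDc M}

/-- `D^f(R^o)` as a class of objects. -/
def Dfo : Set Co := {M | S.memDfo M}

/-- `D^c(R^o)` as a class of objects. -/
def Dco : Set Co := {M | S.memDco M}

/-- The total dimension `dim_k H(R)` of the cohomology of `R`. -/
noncomputable def dimH : Cardinal :=
  Cardinal.sum fun i : ℤ => Module.rank k (S.H S.R i)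

/-- The invariant `φ(M) = dim_k Ext_R(M, k)`, with `Ext^i_R(M,k) = Hom_{D(R)}(M, Σ^i k)`. -/
noncomputable def phi (M : C) : Cardinal :=
  Cardinal.sum fun i : ℤ => Module.rank k (M ⟶ S.kMod⟦i⟧)

/-- `R` is a Gorenstein DG algebra: `D(R) ≅ Σ^d R` in `D(R)` and in `D(R^o)`. -/
def Gorenstein : Prop :=
  Nonempty (S.DR ≅ S.R⟦S.d⟧) ∧ Nonempty (S.DRo ≅ S.Ro⟦S.d⟧)

/-- The left action `H^i(R) × H^j(M) → H^{i+j}(M)` of the cohomology algebra of `R` on the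
cohomology of a DG left module, given by (shifted) composition in `D(R)`. -/
noncomputable def hsmul (M : C) {i j : ℤ} (a : S.H S.R i) (x : S.H M j) : S.H M (i + j) :=
  a ≫ (shiftFunctor C i).map x ≫ (shiftFunctorAdd' C j i (i + j) (by omega)).inv.app M

/-- The product on the cohomology algebra `H(R)`, given by composition in `D(R)`. -/
noncomputable def hmul {i j : ℤ} (a : S.H S.R i) (x : S.H S.R j) : S.H S.R (i + j) :=
  S.hsmul S.R a x

/-- Transport of cohomology along an equality of degrees. -/
def hcast (M : C) {i j : ℤ} (h : i = j) : S.H M i →ₗ[k] S.H M j := by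
  subst h; exact LinearMap.id

/-- Right multiplication `x ↦ x · a` on the cohomology algebra, as a linear map. -/
noncomputable def mulRight {m i : ℤ} (a : S.H S.R i) : S.H S.R m →ₗ[k] S.H S.R (m + i) :=
  Linear.rightComp k S.R
    ((shiftFunctor C m).map a ≫ (shiftFunctorAdd' C i m (m + i) (by omega)).inv.app S.R)

/-- Left multiplication `x ↦ a · x` on the cohomology algebra, as a linear map. -/
noncomputable def mulLeft {i m : ℤ} (a : S.H S.R i) : S.H S.R m →ₗ[k] S.H S.R (i + m) :=
  (Linear.rightComp k S.R ((shiftFunctorAdd' C m i (i + m) (by omega)).inv.app S.R)).comp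
    (((Linear.leftComp k ((S.R⟦m⟧)⟦i⟧) a).comp ((shiftFunctor C i).mapLinearMap k)))

/-- There is an isomorphism `D(H(R)) ≅ Σ^n H(R)` of graded left `H(R)`-modules, where
`D(-) = Hom_k(-, k)`: in degree `j` an isomorphism `Hom_k(H^{n-j}(R), k) ≅ H^j(R)`,
compatible with the left action of `H(R)` (the action on the dual being induced by right
multiplication). -/
def dualIsoShiftLeft (n : ℤ) : Prop :=
  ∃ e : ∀ j : ℤ, Module.Dual k (S.H S.R (n - j)) ≃ₗ[k] S.H S.R j,
    ∀ (i j : ℤ) (a : S.H S.R i) (f : Module.Dual k (S.H S.R (n - j))),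
      e (i + j) (f.comp ((S.hcast S.R (show n - (i + j) + i = n - j by omega)).comp
        (S.mulRight a))) = S.hmul a (e j f)

/-- There is an isomorphism `D(H(R)) ≅ Σ^n H(R)` of graded right `H(R)`-modules. -/
def dualIsoShiftRight (n : ℤ) : Prop :=
  ∃ e : ∀ j : ℤ, Module.Dual k (S.H S.R (n - j)) ≃ₗ[k] S.H S.R j,
    ∀ (i j : ℤ) (a : S.H S.R i) (f : Module.Dual k (S.H S.R (n - j))),
      e (j + i) (f.comp ((S.hcast S.R (show i + (n - (j + i)) = n - j by omega)).comp
        (S.mulLeft a))) = S.hmul (e j f) a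

end DGSetup

end Setup

section Statements

variable {k : Type u} [Field k]
variable {C : Type u} [Category.{v} C] [Preadditive C] [HasZeroObject C] [HasShift C ℤ]
  [∀ n : ℤ, (shiftFunctor C n).Additive] [Pretriangulated C]
  [Linear k C] [HasFiniteBiproducts C] [∀ n : ℤ, Functor.Linear k (shiftFunctor C n)]
variable {Co : Type u} [Category.{v} Co] [Preadditive Co] [HasZeroObject Co] [HasShift Co ℤ]
  [∀ n : ℤ, (shiftFunctor Co n).Additive] [Pretriangulated Co]
  [Linear k Co] [HasFiniteBiproducts Co] [∀ n : ℤ, Functor.Linear k (shiftFunctor Co n)]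
set_option linter.unusedSectionVars false

/-- Homs are invariant under shifting both arguments, up to regrouping shifts of the target. -/
noncomputable def homShiftEquiv (X Y : C) (m a b c : ℤ) (hm : m + a = b + c) :
    (X ⟶ Y⟦m⟧) ≃ₗ[k] (X⟦a⟧ ⟶ Y⟦b⟧⟦c⟧) :=
  (LinearEquiv.ofBijective ((shiftFunctor C a).mapLinearMap k)
    (Functor.FullyFaithful.ofFullyFaithful (shiftFunctor C a)).homEquiv.bijective).trans
  (Linear.homCongr k (Iso.refl _)
    ((shiftFunctorAdd' C m a (b + c) hm).symm.app Y ≪≫ (shiftFunctorAdd' C b c (b + c) rfl).app Y))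

/-- Cohomology expressed through morphisms out of shifts of `R`. -/
noncomputable def DGSetup.cohomologyEquiv (S : DGSetup k C Co) (X : C) (i : ℤ) :
    S.H X i ≃ₗ[k] (S.R⟦-i⟧ ⟶ X) :=
  (homShiftEquiv (k := k) S.R X i (-i) 0 0 (by omega)).trans
    (Linear.homCongr k (Iso.refl _)
      ((shiftFunctorZero C ℤ).app _ ≪≫ (shiftFunctorZero C ℤ).app X))

lemma eq_zero_of_forall_shift_neg {A B : C} (n : ℤ) (hA : ∀ f : A ⟶ B⟦-n⟧, f = 0)
    (f : A⟦n⟧ ⟶ B) : f = 0 := by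
  apply (shiftFunctor C (-n)).map_injective
  rw [Functor.map_zero, ← cancel_epi ((shiftFunctorCompIsoId C n (-n) (by omega)).inv.app A),
    comp_zero]
  exact hA _

lemma eq_zero_of_forall_shift {A B : C} (n : ℤ) (hA : ∀ f : A⟦n⟧ ⟶ B, f = 0)
    (f : A ⟶ B⟦-n⟧) : f = 0 := by
  apply (shiftFunctor C n).map_injective
  rw [Functor.map_zero, ← cancel_mono ((shiftFunctorCompIsoId C (-n) n (by omega)).hom.app B),
    zero_comp]
  exact hA _

lemma eq_zero_of_iso_source {A A' B : C} (e : A ≅ A') (hA : ∀ f : A ⟶ B, f = 0) (f : A' ⟶ B) :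
    f = 0 := by
  exact (cancel_epi e.hom).1 ((hA _).trans comp_zero.symm)

/-- An object finitely built from `R` admits no nonzero morphism to an object whose cohomology
vanishes up to a sufficiently large degree. -/
lemma FinitelyBuilt.exists_bound {R M : C} (hM : FinitelyBuilt C R M) :
    ∃ N : ℤ, ∀ X : C, (∀ i ≤ N, ∀ f : R⟦-i⟧ ⟶ X, f = 0) → ∀ f : M ⟶ X, f = 0 := by
  have shift_case : ∀ (n : ℤ) (M : C),
      (∃ N : ℤ, ∀ X : C, (∀ i ≤ N, ∀ f : R⟦-i⟧ ⟶ X, f = 0) → ∀ f : M ⟶ X, f = 0) →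
      ∃ N : ℤ, ∀ X : C, (∀ i ≤ N, ∀ f : R⟦-i⟧ ⟶ X, f = 0) → ∀ f : M⟦n⟧ ⟶ X, f = 0 := by
    rintro n M ⟨N, hN⟩
    refine ⟨N - n, fun X hX => eq_zero_of_forall_shift_neg n (hN _ fun i hi => ?_)⟩
    exact eq_zero_of_forall_shift n (eq_zero_of_iso_source
      ((shiftFunctorAdd' C (-i) n (-(i - n)) (by omega)).app R) (hX (i - n) (by omega)))
  induction hM with
  | base =>
    exact ⟨0, fun X hX => eq_zero_of_iso_source
      ((shiftFunctorZero' C (-(0 : ℤ)) (by omega)).app R) (hX 0 le_rfl)⟩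
  | iso e _ ih =>
    obtain ⟨N, hN⟩ := ih
    exact ⟨N, fun X hX => eq_zero_of_iso_source e (hN X hX)⟩
  | shift n _ ih => exact shift_case n _ ih
  | cone f g h hT _ _ ihX ihY =>
    obtain ⟨N, hN⟩ := shift_case 1 _ ihX
    obtain ⟨N', hN'⟩ := ihY
    refine ⟨max N N', fun X hX u => ?_⟩
    obtain ⟨v, hv⟩ : ∃ v, u = h ≫ v := Triangle.yoneda_exact₃ _ hT u
      (hN' X (fun i hi => hX i (hi.trans (le_max_right _ _))) _)
    rw [hv, hN X (fun i hi => hX i (hi.trans (le_max_left _ _))) v, comp_zero]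
  | retract i r hir _ ih =>
    obtain ⟨N, hN⟩ := ih
    refine ⟨N, fun X hX f => ?_⟩
    rw [← Category.id_comp f, ← hir, Category.assoc, hN X hX (r ≫ f), comp_zero]

namespace DGSetup

variable (S : DGSetup k C Co)

/-- `Y` is obtained from `M` by killing the cohomology in degrees `< n` through attaching shifted
copies of `R`, and the cohomology of `Y` lies below degree `d + n`. -/
structure IsKilling (M : C) (n : ℤ) (Y : C) : Prop where
  low : ∀ i < n, ∀ f : S.R⟦-i⟧ ⟶ Y, f = 0
  high : ∀ i, S.d + n ≤ i → ∀ f : S.R⟦-i⟧ ⟶ Y, f = 0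
  finite : ∀ i : ℤ, FiniteDimensional k (S.R⟦-i⟧ ⟶ Y)
  not_isZero : ¬ IsZero Y
  orth : ∀ X : C, (∀ i < n, ∀ f : S.R⟦-i⟧ ⟶ X, f = 0) → (∀ f : M ⟶ X, f = 0) →
    ∀ f : Y ⟶ X, f = 0

lemma eq_zero_of_neg {i n : ℤ} (hi : i + 1 < n) (f : S.R⟦-i⟧ ⟶ S.R⟦-n⟧⟦(1 : ℤ)⟧) : f = 0 := by
  have := S.HR_neg (i + 1 - n) (by omega)
  exact ((homShiftEquiv (k := k) S.R S.R (i + 1 - n) (-i) (-n) 1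
    (by omega)).symm.injective.subsingleton).elim _ _

lemma eq_zero_of_one {n : ℤ} (f : S.R⟦-n⟧ ⟶ S.R⟦-n⟧⟦(1 : ℤ)⟧) : f = 0 := by
  have := S.HR_one
  exact ((homShiftEquiv (k := k) S.R S.R 1 (-n) (-n) 1
    (by omega)).symm.injective.subsingleton).elim _ _

lemma subsingleton_of_d_lt {i : ℤ} (hi : S.d < i) : Subsingleton (S.R ⟶ S.R⟦i⟧) := by
  by_contra hne
  exact absurd (S.d_greatest i (not_subsingleton_iff_nontrivial.1 hne)) (by omega)

lemma eq_zero_of_d_lt {i n : ℤ} (hi : S.d + n ≤ i) (f : S.R⟦-i⟧ ⟶ S.R⟦-n⟧⟦(1 : ℤ)⟧) :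
    f = 0 := by
  have := S.subsingleton_of_d_lt (i := i + 1 - n) (by omega)
  exact ((homShiftEquiv (k := k) S.R S.R (i + 1 - n) (-i) (-n) 1
    (by omega)).symm.injective.subsingleton).elim _ _

lemma nontrivial_top (n : ℤ) : Nontrivial (S.R⟦-(S.d + n)⟧ ⟶ S.R⟦-n⟧) := by
  have := S.d_mem
  exact ((homShiftEquiv (k := k) S.R S.R S.d (-(S.d + n)) (-n) 0 (by omega)).trans
    (Linear.homCongr k (Iso.refl _) ((shiftFunctorZero C ℤ).app _))).symm.toEquiv.nontrivial

lemma finiteDimensional_shift (i n : ℤ) :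
    FiniteDimensional k (S.R⟦-i⟧ ⟶ S.R⟦-n⟧⟦(1 : ℤ)⟧) := by
  have := S.HR_findim (i + 1 - n)
  exact Module.Finite.equiv (homShiftEquiv (k := k) S.R S.R (i + 1 - n) (-i) (-n) 1 (by omega))

lemma finrank_shift {i n : ℤ} (hi : i + 1 = n) :
    Module.finrank k (S.R⟦-i⟧ ⟶ S.R⟦-n⟧⟦(1 : ℤ)⟧) = 1 := by
  obtain ⟨e⟩ := S.HR_zero
  rw [← ((homShiftEquiv (k := k) S.R S.R 0 (-i) (-n) 1 (by omega))).finrank_eq, e.finrank_eq,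
    Module.finrank_self]

variable {S} in
/-- Coning off a nonzero cohomology class in the lowest degree. -/
lemma IsKilling.cone {M Y Z : C} {n : ℤ} (hY : S.IsKilling M n Y) {f : S.R⟦-n⟧ ⟶ Y}
    (hf : f ≠ 0) {g : Y ⟶ Z} {h : Z ⟶ S.R⟦-n⟧⟦(1 : ℤ)⟧}
    (hT : Triangle.mk f g h ∈ distTriang C) :
    S.IsKilling M n Z where
  low i hi u := by
    have hu : u ≫ h = 0 := by
      by_cases hin : i + 1 < n
      · exact S.eq_zero_of_neg hin _
      · have hin : i + 1 = n := by omega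
        let e : S.R⟦-i⟧ ≅ S.R⟦-n⟧⟦(1 : ℤ)⟧ :=
          (shiftFunctorAdd' C (-n) 1 (-i) (by omega)).app S.R
        have hf1 : f⟦(1 : ℤ)⟧' ≠ 0 := fun H =>
          hf ((shiftFunctor C (1 : ℤ)).map_injective (H.trans (Functor.map_zero _ _ _).symm))
        have he : e.hom ≠ 0 := fun H => hf1 (by
          rw [← cancel_epi e.hom, H, zero_comp, zero_comp])
        obtain ⟨c, hc⟩ := (finrank_eq_one_iff_of_nonzero' e.hom he).1 (S.finrank_shift hin) (u ≫ h)
        have h0 : h ≫ f⟦(1 : ℤ)⟧' = 0 := comp_distTriang_mor_zero₃₁ _ hT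
        have h1 : (c • e.hom) ≫ f⟦(1 : ℤ)⟧' = 0 := by
          rw [hc, Category.assoc, h0, comp_zero]
        rw [Linear.smul_comp, smul_eq_zero] at h1
        rcases h1 with h1 | h1
        · rw [← hc, h1, zero_smul]
        · exact absurd ((cancel_epi e.hom).1 (h1.trans comp_zero.symm)) hf1
    obtain ⟨v, hv⟩ : ∃ v, u = v ≫ g := Triangle.coyoneda_exact₃ _ hT u hu
    rw [hv, hY.low i hi v, zero_comp]
  high i hi u := by
    obtain ⟨v, hv⟩ : ∃ v, u = v ≫ g := Triangle.coyoneda_exact₃ _ hT u (S.eq_zero_of_d_lt hi _)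
    rw [hv, hY.high i hi v, zero_comp]
  finite i := by
    have := hY.finite i
    have := S.finiteDimensional_shift i n
    have hker : LinearMap.ker (Linear.rightComp k (S.R⟦-i⟧) h) ≤
        LinearMap.range (Linear.rightComp k (S.R⟦-i⟧) g) := by
      intro u hu
      obtain ⟨v, hv⟩ : ∃ v, u = v ≫ g := Triangle.coyoneda_exact₃ _ hT u hu
      exact ⟨v, hv.symm⟩
    have := Submodule.finiteDimensional_of_le hker
    have := Module.Finite.equiv
      (LinearMap.quotKerEquivRange (Linear.rightComp k (S.R⟦-i⟧) h)).symm
    exact Module.Finite.of_submodule_quotient (LinearMap.ker (Linear.rightComp k (S.R⟦-i⟧) h))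
  not_isZero hZ := by
    have : IsIso f := (Triangle.isZero₃_iff_isIso₁ _ hT).1 hZ
    have := S.nontrivial_top n
    obtain ⟨u, hu⟩ := exists_ne (0 : S.R⟦-(S.d + n)⟧ ⟶ S.R⟦-n⟧)
    apply hu
    rw [← cancel_mono f, zero_comp]
    exact hY.high _ le_rfl _
  orth X hX hM u := by
    obtain ⟨v, hv⟩ : ∃ v, u = h ≫ v := Triangle.yoneda_exact₃ _ hT u (hY.orth X hX hM _)
    rw [hv, eq_zero_of_iso_source ((shiftFunctorAdd' C (-n) 1 (-(n - 1)) (by omega)).app S.R)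
      (hX (n - 1) (by omega)) v, comp_zero]

variable {S} in
lemma IsKilling.finrank_cone_lt {M Y Z : C} {n : ℤ} (hY : S.IsKilling M n Y) {f : S.R⟦-n⟧ ⟶ Y}
    (hf : f ≠ 0) {g : Y ⟶ Z} {h : Z ⟶ S.R⟦-n⟧⟦(1 : ℤ)⟧}
    (hT : Triangle.mk f g h ∈ distTriang C) :
    Module.finrank k (S.R⟦-n⟧ ⟶ Z) < Module.finrank k (S.R⟦-n⟧ ⟶ Y) := by
  have := hY.finite n
  let φ := Linear.rightComp k (S.R⟦-n⟧) g
  have hφ : Function.Surjective φ := fun u => by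
    obtain ⟨v, hv⟩ : ∃ v, u = v ≫ g := Triangle.coyoneda_exact₃ _ hT u (S.eq_zero_of_one _)
    exact ⟨v, hv.symm⟩
  have hfker : f ∈ LinearMap.ker φ := comp_distTriang_mor_zero₁₂ _ hT
  have : Nontrivial (LinearMap.ker φ) := ⟨⟨f, hfker⟩, 0, fun H => hf (congrArg Subtype.val H)⟩
  have hpos : 0 < Module.finrank k (LinearMap.ker φ) := Module.finrank_pos
  have hsum := φ.finrank_range_add_finrank_ker
  rw [LinearMap.range_eq_top.2 hφ, finrank_top] at hsum
  omega

variable {S} in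
lemma IsKilling.exists_succ {M Y : C} {n : ℤ} (hY : S.IsKilling M n Y) :
    ∃ Z, S.IsKilling M (n + 1) Z := by
  induction hr : Module.finrank k (S.R⟦-n⟧ ⟶ Y) using Nat.strong_induction_on generalizing Y with
  | _ r ih =>
    by_cases h0 : ∀ f : S.R⟦-n⟧ ⟶ Y, f = 0
    · exact ⟨Y,
        { low := fun i hi => by
            rcases (Int.lt_add_one_iff.1 hi).lt_or_eq with hlt | rfl
            · exact hY.low i hlt
            · exact h0
          high := fun i hi => hY.high i (by omega)
          finite := hY.finite
          not_isZero := hY.not_isZero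
          orth := fun X hX => hY.orth X fun i hi => hX i (by omega) }⟩
    · obtain ⟨f, hf⟩ := not_forall.1 h0
      obtain ⟨Z, g, h, hT⟩ := distinguished_cocone_triangle f
      exact ih _ (hr ▸ hY.finrank_cone_lt hf hT) (hY.cone hf hT) rfl

lemma d_pos (h : 2 ≤ S.dimH) : 0 < S.d := by
  by_contra hd
  have hle : S.dimH ≤ 1 := by
    have hrank : ∀ i : ℤ, Module.rank k (S.H S.R i) = Cardinal.mk (ULift.{v} (PLift (i = 0))) := by
      intro i
      by_cases hi : i = 0
      · subst hi
        obtain ⟨e⟩ := S.HR_zero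
        have : Module.finrank k (S.H S.R 0) = 1 := by rw [e.finrank_eq, Module.finrank_self]
        rw [Module.rank_eq_one_iff_finrank_eq_one.2 this]
        simp
      · have : Subsingleton (S.R ⟶ S.R⟦i⟧) := by
          rcases lt_or_gt_of_ne hi with hi | hi
          · exact S.HR_neg i hi
          · exact S.subsingleton_of_d_lt (by omega)
        rw [rank_subsingleton']
        simp [hi]
    rw [dimH, funext hrank, ← Cardinal.mk_sigma, Cardinal.le_one_iff_subsingleton]
    refine ⟨?_⟩
    rintro ⟨_, ⟨⟨rfl⟩⟩⟩ ⟨_, ⟨⟨rfl⟩⟩⟩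
    rfl
  exact absurd (h.trans hle) (by simp)

lemma isKilling_kMod (hd : 0 < S.d) : S.IsKilling S.kMod 0 S.kMod := by
  have hne : ∀ i : ℤ, i ≠ 0 → ∀ f : S.R⟦-i⟧ ⟶ S.kMod, f = 0 := fun i hi f => by
    have := S.Hk_ne i hi
    exact ((S.cohomologyEquiv S.kMod i).symm.injective.subsingleton).elim _ _
  obtain ⟨e⟩ := S.Hk_zero
  refine ⟨fun i hi => hne i (by omega), fun i hi => hne i (by omega), fun i => ?_, fun hZ => ?_,
    fun X _ hX => hX⟩
  · by_cases hi : i = 0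
    · subst hi
      exact Module.Finite.equiv (e.symm.trans (S.cohomologyEquiv S.kMod 0))
    · have := S.Hk_ne i hi
      exact Module.Finite.equiv (S.cohomologyEquiv S.kMod i)
  · exact zero_ne_one ((e.symm.trans (S.cohomologyEquiv S.kMod 0)).injective
      (hZ.eq_of_tgt _ _) : (0 : k) = 1)

lemma exists_isKilling (hd : 0 < S.d) (n : ℕ) : ∃ Y, S.IsKilling S.kMod n Y := by
  induction n with
  | zero => exact ⟨_, S.isKilling_kMod hd⟩
  | succ n ih =>
    obtain ⟨Y, hY⟩ := ih
    exact_mod_cast hY.exists_succ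

end DGSetup

/-- If `dim_k H(R) ≥ 2`, then the DG left-`R`-module `k` (that is,
`k = R/R^{≥1}` viewed in `D(R)`) is not in `D^c(R)`. -/
theorem k_not_compact (S : DGSetup k C Co) (h : 2 ≤ S.dimH) :
    ¬ S.memDc S.kMod := by
  intro hk
  obtain ⟨N, hN⟩ := hk.exists_bound
  obtain ⟨Y, hY⟩ := S.exists_isKilling (S.d_pos h) (N + 1).toNat
  exact hY.not_isZero ((IsZero.iff_id_eq_zero Y).2
    (hY.orth Y hY.low (hN Y fun i hi => hY.low i (by omega)) _))

end Statements
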